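/- arXiv:2602.09073 — 7 statements merged into one kernel-verified Lean document; each statement's English description precedes it below -/
import Mathlib

section
/- Let n ≥ 2 be an even integer. Then in the dicyclic group Dic_{4n}: the number of MSTD subsets of cardinality 2 is S_{Dic_{4n}}(2) = 4n(n−2), the number of MDTS subsets of cardinality 2 is D_{Dic_{4n}}(2) = 0, and the number of balanced subsets of cardinality 2 is B_{Dic_{4n}}(2) = 2n(2n+3). -/
open Finset Pointwise

/-- A finset of a group is MSTD if its sumset `A * A` is larger than its
difference set `A / A = {a₁ * a₂⁻¹}`. -/
def IsMSTD {G : Type*} [Group G] [DecidableEq G] (A : Finset G) : Prop :=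
  (A / A).card < (A * A).card

/-- A finset of a group is MDTS if its sumset is smaller than its difference set. -/
def IsMDTS {G : Type*} [Group G] [DecidableEq G] (A : Finset G) : Prop :=
  (A * A).card < (A / A).card

/-- A finset of a group is balanced if its sumset and difference set have equal size. -/
def IsBalanced {G : Type*} [Group G] [DecidableEq G] (A : Finset G) : Prop :=
  (A * A).card = (A / A).card


namespace QuaternionGroup

variable {n : ℕ}

lemma natCast_add_self_eq_zero (n : ℕ) : (n : ZMod (2 * n)) + n = 0 := by
  rw [← two_mul]
  exact_mod_cast ZMod.natCast_self (2 * n)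

lemma a_div_a (i j : ZMod (2 * n)) : a i / a j = a (i - j) :=
  congrArg a (sub_eq_add_neg i j).symm

lemma a_div_xa (i j : ZMod (2 * n)) : a i / xa j = xa ((n : ZMod (2 * n)) + j - i) := rfl

lemma xa_div_a (i j : ZMod (2 * n)) : xa i / a j = xa (i - j) :=
  congrArg xa (sub_eq_add_neg i j).symm

lemma xa_div_xa (i j : ZMod (2 * n)) : xa i / xa j = a (j - i) := by
  have hz := natCast_add_self_eq_zero n
  refine (congrArg a ?_ : a ((n : ZMod (2 * n)) + ((n : ZMod (2 * n)) + j) - i) = a (j - i))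
  grind

lemma card_mul_eq_card_div_pair_a (i j : ZMod (2 * n)) :
    (({a i, a j} : Finset (QuaternionGroup n)) * {a i, a j}).card =
      (({a i, a j} : Finset (QuaternionGroup n)) / {a i, a j}).card := by
  rw [← card_mul_singleton ({a i, a j} / {a i, a j}) (a (i + j))]
  congr 1
  ext (k | k) <;>
  simp only [Finset.mem_mul, Finset.mem_div, mem_insert, mem_singleton, a_div_a,
    exists_eq_left, exists_eq_left', or_and_right, exists_or, a_mul_a, a.injEq, reduceCtorEq,
    or_false]
  grind

lemma card_mul_eq_card_div_pair_xa (i j : ZMod (2 * n)) :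
    (({xa i, xa j} : Finset (QuaternionGroup n)) * {xa i, xa j}).card =
      (({xa i, xa j} : Finset (QuaternionGroup n)) / {xa i, xa j}).card := by
  rw [← card_mul_singleton ({xa i, xa j} / {xa i, xa j}) (a n)]
  congr 1
  have hz := natCast_add_self_eq_zero n
  ext (k | k) <;>
  simp only [Finset.mem_mul, Finset.mem_div, mem_insert, mem_singleton, xa_div_xa,
    exists_eq_left, exists_eq_left', or_and_right, exists_or, xa_mul_xa, a_mul_a, a.injEq,
    reduceCtorEq, or_false]
  grind

lemma natCast_ne_zero (hn : n ≠ 0) : (n : ZMod (2 * n)) ≠ 0 := by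
  rw [Ne, ZMod.natCast_eq_zero_iff]
  intro h
  have := Nat.le_of_dvd (by omega) h
  omega

lemma card_div_pair_a_xa (hn : n ≠ 0) (i j : ZMod (2 * n)) :
    (({a i, xa j} : Finset (QuaternionGroup n)) / {a i, xa j}).card = 3 := by
  have h0 := natCast_ne_zero hn
  have hz := natCast_add_self_eq_zero n
  have : ({a i, xa j} : Finset (QuaternionGroup n)) / {a i, xa j} =
      {a 0, xa (j - i), xa ((n : ZMod (2 * n)) + j - i)} := by
    ext (k | k) <;>
    simp only [Finset.mem_div, mem_insert, mem_singleton, a_div_a, a_div_xa, xa_div_a, xa_div_xa,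
      exists_eq_left, or_and_right, exists_or, a.injEq, xa.injEq, reduceCtorEq, or_false,
      false_or] <;>
    grind
  rw [this, card_eq_three]
  refine ⟨_, _, _, by simp [-a_zero], by simp [-a_zero], ?_, rfl⟩
  simpa [add_sub_assoc] using h0

lemma mul_pair_a_xa (i j : ZMod (2 * n)) :
    (({a i, xa j} : Finset (QuaternionGroup n)) * {a i, xa j}) =
      ({i + i, (n : ZMod (2 * n))} : Finset (ZMod (2 * n))).image a ∪
        ({j - i, j + i} : Finset (ZMod (2 * n))).image xa := by
  ext (k | k) <;>
  simp only [Finset.mem_mul, mem_insert, mem_singleton, exists_eq_left,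
    or_and_right, exists_or, xa_mul_xa, a_mul_a, a_mul_xa, xa_mul_a, a.injEq, xa.injEq,
    reduceCtorEq, or_false, false_or, mem_union, mem_image] <;>
  grind

lemma card_mul_pair_a_xa (i j : ZMod (2 * n)) :
    (({a i, xa j} : Finset (QuaternionGroup n)) * {a i, xa j}).card =
      (if i + i = n then 1 else 2) + if i + i = 0 then 1 else 2 := by
  have hj : j - i = j + i ↔ i + i = 0 := by grind
  rw [mul_pair_a_xa, card_union_of_disjoint, card_image_of_injective _ fun _ _ => a.inj,
    card_image_of_injective _ fun _ _ => xa.inj, card_insert_eq_ite, card_insert_eq_ite]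
  · simp only [mem_singleton, card_singleton, hj]
  · simp [Finset.disjoint_left]

lemma not_isMDTS_of_card_eq_two (hn : n ≠ 0) {A : Finset (QuaternionGroup n)} (hA : A.card = 2) :
    ¬ IsMDTS A := by
  have h0 := natCast_ne_zero hn
  have key (i j : ZMod (2 * n)) : ¬ IsMDTS ({a i, xa j} : Finset (QuaternionGroup n)) := by
    rw [IsMDTS, card_div_pair_a_xa hn, card_mul_pair_a_xa]
    split_ifs <;> simp_all
  obtain ⟨x, y, -, rfl⟩ := card_eq_two.mp hA
  rcases x with i | i <;> rcases y with j | j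
  · simp [IsMDTS, card_mul_eq_card_div_pair_a]
  · exact key i j
  · rw [pair_comm]
    exact key j i
  · simp [IsMDTS, card_mul_eq_card_div_pair_xa]

lemma isMSTD_pair_a_xa_iff (hn : n ≠ 0) (i j : ZMod (2 * n)) :
    IsMSTD ({a i, xa j} : Finset (QuaternionGroup n)) ↔ i + i ≠ 0 ∧ i + i ≠ n := by
  have h0 := natCast_ne_zero hn
  rw [IsMSTD, card_div_pair_a_xa hn, card_mul_pair_a_xa]
  split_ifs <;> simp_all

lemma setOf_isMSTD_card_two_eq_image (hn : n ≠ 0) :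
    {A : Finset (QuaternionGroup n) | A.card = 2 ∧ IsMSTD A} =
      (fun p : ZMod (2 * n) × ZMod (2 * n) => {a p.1, xa p.2}) ''
        ({i : ZMod (2 * n) | i + i ≠ 0 ∧ i + i ≠ n} ×ˢ Set.univ) := by
  ext A
  simp only [Set.mem_ofPred_eq, Set.mem_image, Set.mem_prod, Set.mem_univ, and_true, Prod.exists]
  constructor
  · rintro ⟨hA, hM⟩
    obtain ⟨x, y, -, rfl⟩ := card_eq_two.mp hA
    rcases x with i | i <;> rcases y with j | j
    · simp [IsMSTD, card_mul_eq_card_div_pair_a] at hM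
    · exact ⟨i, j, (isMSTD_pair_a_xa_iff hn i j).mp hM, rfl⟩
    · rw [pair_comm] at hM
      exact ⟨j, i, (isMSTD_pair_a_xa_iff hn j i).mp hM, pair_comm _ _⟩
    · simp [IsMSTD, card_mul_eq_card_div_pair_xa] at hM
  · rintro ⟨i, j, h, rfl⟩
    exact ⟨card_pair (by simp), (isMSTD_pair_a_xa_iff hn i j).mpr h⟩

lemma pair_a_xa_injective :
    Function.Injective fun p : ZMod (2 * n) × ZMod (2 * n) =>
      ({a p.1, xa p.2} : Finset (QuaternionGroup n)) := by
  rintro ⟨i, j⟩ ⟨i', j'⟩ h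
  have h1 := Finset.ext_iff.mp h (a i)
  have h2 := Finset.ext_iff.mp h (xa j)
  simp only [mem_insert, mem_singleton, a.injEq, xa.injEq, reduceCtorEq, or_false, false_or,
    true_iff] at h1 h2
  rw [h1, h2]

lemma ncard_setOf_add_self_ne (hn : n ≠ 0) (heven : Even n) :
    {i : ZMod (2 * n) | i + i ≠ 0 ∧ i + i ≠ n}.ncard = 2 * n - 4 := by
  have : NeZero (2 * n) := ⟨by omega⟩
  obtain ⟨m, hm⟩ := heven
  have hS : {i : ZMod (2 * n) | i + i ≠ 0 ∧ i + i ≠ n} =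
      ((({0, m, n, n + m} : Finset ℕ).image (Nat.cast : ℕ → ZMod (2 * n)))ᶜ :
        Finset (ZMod (2 * n))) := by
    ext i
    obtain ⟨k, hk, rfl⟩ : ∃ k < 2 * n, (k : ZMod (2 * n)) = i :=
      ⟨i.val, i.val_lt, ZMod.natCast_zmod_val i⟩
    have hcast {x y : ℕ} (hx : x < 2 * n) (hy : y < 2 * n) :
        (x : ZMod (2 * n)) = y ↔ x = y := by
      rw [ZMod.natCast_eq_natCast_iff', Nat.mod_eq_of_lt hx, Nat.mod_eq_of_lt hy]
    have hdouble {y : ℕ} (hy : y < 2 * n) :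
        (k : ZMod (2 * n)) + k = y ↔ k + k = y ∨ k + k = y + 2 * n := by
      rw [← Nat.cast_add, ZMod.natCast_eq_natCast_iff', Nat.mod_eq_of_lt hy]
      rcases lt_or_ge (k + k) (2 * n) with h | h
      · rw [Nat.mod_eq_of_lt h]
        omega
      · rw [Nat.mod_eq_sub_mod h, Nat.mod_eq_of_lt (by omega)]
        omega
    have hd0 := hdouble (y := 0) (by omega)
    rw [Nat.cast_zero] at hd0
    simp only [Set.mem_ofPred_eq, coe_compl, Set.mem_compl_iff, mem_coe, image_insert,
      image_singleton, mem_insert, mem_singleton, ne_eq, hd0, hdouble (y := n) (by omega),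
      hcast hk (show 0 < 2 * n by omega), hcast hk (show m < 2 * n by omega),
      hcast hk (show n < 2 * n by omega), hcast hk (show n + m < 2 * n by omega)]
    omega
  rw [hS, Set.ncard_coe_finset, card_compl, ZMod.card, card_image_of_injOn]
  · congr 1
    rw [card_insert_of_notMem, card_insert_of_notMem, card_pair] <;> grind
  · intro x hx y hy hxy
    simp only [coe_insert, coe_singleton, Set.mem_insert_iff, Set.mem_singleton_iff] at hx hy
    simp only [ZMod.natCast_eq_natCast_iff'] at hxy
    rwa [Nat.mod_eq_of_lt (by omega), Nat.mod_eq_of_lt (by omega)] at hxy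

lemma ncard_setOf_card_two [NeZero n] :
    {A : Finset (QuaternionGroup n) | A.card = 2}.ncard = 2 * n * (4 * n - 1) := by
  have : {A : Finset (QuaternionGroup n) | A.card = 2} =
      (powersetCard 2 (univ : Finset (QuaternionGroup n)) : Set (Finset (QuaternionGroup n))) := by
    ext; simp
  rw [this, Set.ncard_coe_finset, card_powersetCard, card_univ, QuaternionGroup.card,
    Nat.choose_two_right]
  apply Nat.div_eq_of_eq_mul_left two_pos
  ring

end QuaternionGroup

theorem stmt_0 (n : ℕ) (hn : 2 ≤ n) (heven : Even n) :
    {A : Finset (QuaternionGroup n) | A.card = 2 ∧ IsMSTD A}.ncard = 4 * n * (n - 2) ∧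
    {A : Finset (QuaternionGroup n) | A.card = 2 ∧ IsMDTS A}.ncard = 0 ∧
    {A : Finset (QuaternionGroup n) | A.card = 2 ∧ IsBalanced A}.ncard = 2 * n * (2 * n + 3) := by
  have hn0 : n ≠ 0 := by omega
  have : NeZero n := ⟨hn0⟩
  have hM : {A : Finset (QuaternionGroup n) | A.card = 2 ∧ IsMSTD A}.ncard = 4 * n * (n - 2) := by
    rw [QuaternionGroup.setOf_isMSTD_card_two_eq_image hn0,
      Set.ncard_image_of_injective _ QuaternionGroup.pair_a_xa_injective, Set.ncard_prod,
      QuaternionGroup.ncard_setOf_add_self_ne hn0 heven, Set.ncard_univ, Nat.card_zmod]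
    obtain ⟨k, rfl⟩ := Nat.exists_eq_add_of_le hn
    rw [show 2 * (2 + k) - 4 = 2 * k by omega, show 2 + k - 2 = k by omega]
    ring
  refine ⟨hM, ?_, ?_⟩
  · rw [Set.ncard_eq_zero]
    exact Set.eq_empty_of_forall_notMem fun A hA =>
      QuaternionGroup.not_isMDTS_of_card_eq_two hn0 hA.1 hA.2
  · have hB : {A : Finset (QuaternionGroup n) | A.card = 2 ∧ IsBalanced A} =
        {A | A.card = 2} \ {A | A.card = 2 ∧ IsMSTD A} := by
      ext A
      have h : A.card = 2 → ¬ IsMDTS A := QuaternionGroup.not_isMDTS_of_card_eq_two hn0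
      simp only [Set.mem_ofPred_eq, Set.mem_sdiff, IsBalanced, IsMSTD, IsMDTS] at h ⊢
      omega
    rw [hB, Set.ncard_sdiff fun A hA => hA.1, hM, QuaternionGroup.ncard_setOf_card_two]
    obtain ⟨k, rfl⟩ := Nat.exists_eq_add_of_le hn
    rw [show 4 * (2 + k) - 1 = 4 * k + 7 by omega, show 2 + k - 2 = k by omega]
    apply Nat.sub_eq_of_eq_add
    ring
end

section
/- Let n ≥ 3 be an odd integer with 3 ∤ n. Let T_n be the set of integer triples (i, j, k) with 0 ≤ i < j < k ≤ 2n−1 such that at least one of the congruences 2i ≡ j+k (mod 2n), 2j ≡ i+k (mod 2n), 2k ≡ i+j (mod 2n) holds. Then |T_n| = 2n(n−1). -/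
theorem Nat.ModEq.eq_of_lt_add {N a b : ℕ} (h : a ≡ b [MOD N]) (hab : a < b + N)
    (hba : b < a + N) : a = b := by
  have hdvd : (N : ℤ) ∣ (b : ℤ) - a := Nat.modEq_iff_dvd.1 h
  have := Int.eq_zero_of_abs_lt_dvd hdvd (abs_lt.2 ⟨by omega, by omega⟩)
  omega

/-- The increasing triple formed by the residues modulo `2 * n` of `m - d`, `m` and `m + d`,
where `p = (m, d)`. -/
def sortedProgression (n : ℕ) (p : ℕ × ℕ) : ℕ × ℕ × ℕ :=
  if p.1 < p.2 then (p.1, p.1 + p.2, p.1 + 2 * n - p.2)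
  else if p.1 + p.2 < 2 * n then (p.1 - p.2, p.1, p.1 + p.2)
  else (p.1 + p.2 - 2 * n, p.1 - p.2, p.1)

theorem sortedProgression_injOn {n : ℕ} (hndvd : ¬ 3 ∣ n) :
    Set.InjOn (sortedProgression n) (Finset.range (2 * n) ×ˢ Finset.Icc 1 (n - 1)) := by
  rintro ⟨m, d⟩ h ⟨m', d'⟩ h' heq
  simp only [Set.mem_prod, Finset.mem_coe, Finset.mem_range, Finset.mem_Icc] at h h'
  simp only [sortedProgression] at heq
  rw [Prod.mk.injEq]
  split_ifs at heq <;> simp only [Prod.mk.injEq] at heq <;> omega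

theorem modEq_triple_iff {n i j k : ℕ} (hij : i < j) (hjk : j < k) (hk : k < 2 * n) :
    (2 * i ≡ j + k [MOD 2 * n] ∨ 2 * j ≡ i + k [MOD 2 * n] ∨ 2 * k ≡ i + j [MOD 2 * n]) ↔
      2 * i + 2 * n = j + k ∨ 2 * j = i + k ∨ 2 * k = i + j + 2 * n := by
  have hi : 2 * i ≡ j + k [MOD 2 * n] ↔ 2 * i + 2 * n = j + k :=
    ⟨fun h ↦ (Nat.add_modEq_right.trans h).eq_of_lt_add (by omega) (by omega),
      fun h ↦ Nat.add_modEq_right.symm.trans (h ▸ rfl)⟩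
  have hj : 2 * j ≡ i + k [MOD 2 * n] ↔ 2 * j = i + k :=
    ⟨fun h ↦ h.eq_of_lt_add (by omega) (by omega), fun h ↦ h ▸ rfl⟩
  have hk : 2 * k ≡ i + j [MOD 2 * n] ↔ 2 * k = i + j + 2 * n :=
    ⟨fun h ↦ (h.trans Nat.add_modEq_right.symm).eq_of_lt_add (by omega) (by omega),
      fun h ↦ h ▸ Nat.add_modEq_right⟩
  rw [hi, hj, hk]

theorem stmt_5 (n : ℕ) (hn : 3 ≤ n) (hodd : Odd n) (hndvd : ¬ 3 ∣ n) :
    {p : ℕ × ℕ × ℕ | p.1 < p.2.1 ∧ p.2.1 < p.2.2 ∧ p.2.2 ≤ 2 * n - 1 ∧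
        (2 * p.1 ≡ p.2.1 + p.2.2 [MOD 2 * n] ∨
         2 * p.2.1 ≡ p.1 + p.2.2 [MOD 2 * n] ∨
         2 * p.2.2 ≡ p.1 + p.2.1 [MOD 2 * n])}.ncard = 2 * n * (n - 1) := by
  have himage : {p : ℕ × ℕ × ℕ | p.1 < p.2.1 ∧ p.2.1 < p.2.2 ∧ p.2.2 ≤ 2 * n - 1 ∧
        (2 * p.1 ≡ p.2.1 + p.2.2 [MOD 2 * n] ∨
         2 * p.2.1 ≡ p.1 + p.2.2 [MOD 2 * n] ∨
         2 * p.2.2 ≡ p.1 + p.2.1 [MOD 2 * n])} =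
      sortedProgression n '' ↑(Finset.range (2 * n) ×ˢ Finset.Icc 1 (n - 1)) := by
    ext ⟨i, j, k⟩
    simp only [Set.mem_ofPred_eq, Set.mem_image, Finset.mem_coe, Finset.mem_product,
      Finset.mem_range, Finset.mem_Icc, Prod.exists]
    constructor
    · rintro ⟨hij, hjk, hk, h⟩
      rw [modEq_triple_iff hij hjk (by omega)] at h
      rcases h with h | h | h
      · refine ⟨i, j - i, by omega, ?_⟩
        simp only [sortedProgression]
        split_ifs <;> simp only [Prod.mk.injEq, true_and] <;> omega
      · refine ⟨j, j - i, by omega, ?_⟩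
        simp only [sortedProgression]
        split_ifs <;> simp only [Prod.mk.injEq, true_and] <;> omega
      · refine ⟨k, k - j, by omega, ?_⟩
        simp only [sortedProgression]
        split_ifs <;> simp only [Prod.mk.injEq, and_true] <;> omega
    · rintro ⟨m, d, hmd, heq⟩
      have key : i < j ∧ j < k ∧ k < 2 * n ∧
          (2 * i + 2 * n = j + k ∨ 2 * j = i + k ∨ 2 * k = i + j + 2 * n) := by
        simp only [sortedProgression] at heq
        split_ifs at heq <;> simp only [Prod.mk.injEq] at heq <;> omega
      obtain ⟨hij, hjk, hk, h⟩ := key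
      exact ⟨hij, hjk, by omega, (modEq_triple_iff hij hjk hk).2 h⟩
  rw [himage, Set.InjOn.ncard_image (by simpa using sortedProgression_injOn hndvd),
    Set.ncard_coe_finset, Finset.card_product, Finset.card_range, Nat.card_Icc,
    Nat.add_sub_cancel]
end

section
/- Let n ≥ 3 be an odd integer with 3 ∣ n. Let T_n be the set of integer triples (i, j, k) with 0 ≤ i < j < k ≤ 2n−1 such that at least one of the congruences 2i ≡ j+k (mod 2n), 2j ≡ i+k (mod 2n), 2k ≡ i+j (mod 2n) holds. Then |T_n| = 2n(3n−5)/3. -/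
lemma modEq_iff_eq_of_abs_sub_lt {M a b : ℕ} (h : |(b : ℤ) - a| < M) :
    a ≡ b [MOD M] ↔ a = b :=
  ⟨fun hab => hab.eq_of_abs_lt h, fun hab => hab ▸ Nat.ModEq.refl a⟩

/-- For `i < j < k < M`, each of the three midpoint congruences modulo `M` is a linear equation. -/
lemma midpoint_modEq_iff {M i j k : ℕ} (hij : i < j) (hjk : j < k) (hk : k < M) :
    (2 * i ≡ j + k [MOD M] ∨ 2 * j ≡ i + k [MOD M] ∨ 2 * k ≡ i + j [MOD M]) ↔
      (2 * i + M = j + k ∨ 2 * j = i + k ∨ 2 * k = i + j + M) := by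
  have h₁ : 2 * i ≡ j + k [MOD M] ↔ 2 * i + M = j + k := by
    rw [← modEq_iff_eq_of_abs_sub_lt (M := M) (by rw [abs_lt]; push_cast; omega)]
    simp [Nat.ModEq]
  have h₂ : 2 * j ≡ i + k [MOD M] ↔ 2 * j = i + k :=
    modEq_iff_eq_of_abs_sub_lt (by rw [abs_lt]; push_cast; omega)
  have h₃ : 2 * k ≡ i + j [MOD M] ↔ 2 * k = i + j + M := by
    rw [← modEq_iff_eq_of_abs_sub_lt (M := M) (by rw [abs_lt]; push_cast; omega)]
    simp [Nat.ModEq]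
  rw [h₁, h₂, h₃]

/-- The pairs `⟨b, a⟩` with `a < b < n`. -/
def triangle (n : ℕ) : Finset (Σ _ : ℕ, ℕ) := (Finset.range n).sigma Finset.range

lemma mem_triangle {n : ℕ} {x : Σ _ : ℕ, ℕ} : x ∈ triangle n ↔ x.1 < n ∧ x.2 < x.1 := by
  simp [triangle]

lemma card_triangle_mul_two (n : ℕ) : (triangle n).card * 2 = n * (n - 1) := by
  simp [triangle, Finset.card_sigma, Finset.sum_range_id_mul_two]

/-- Triples with `j` the midpoint, `j < n`. -/
def lowMiddle (n : ℕ) : Finset (ℕ × ℕ × ℕ) :=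
  (triangle n).image fun x => (x.2, x.1, 2 * x.1 - x.2)

/-- Triples with `j` the midpoint, `n ≤ j`. -/
def highMiddle (n : ℕ) : Finset (ℕ × ℕ × ℕ) :=
  (triangle n).image fun x => (2 * n - 1 - (2 * x.1 - x.2), 2 * n - 1 - x.1, 2 * n - 1 - x.2)

/-- Triples with `i` the midpoint of `j` and `k` modulo `2 * n`. -/
def firstMiddle (n : ℕ) : Finset (ℕ × ℕ × ℕ) :=
  (triangle n).image fun x => (x.2, x.2 + x.1, x.2 + 2 * n - x.1)

/-- Triples with `k` the midpoint of `i` and `j` modulo `2 * n`. -/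
def lastMiddle (n : ℕ) : Finset (ℕ × ℕ × ℕ) :=
  (triangle n).image fun x => (x.1 - x.2 - 1, 2 * n - 1 - x.2 - x.1, 2 * n - 1 - x.2)

/-- Triples `(i, i + d, i + 2 * d)` with `i < d`. -/
def equilateral (d : ℕ) : Finset (ℕ × ℕ × ℕ) :=
  (Finset.range d).image fun i => (i, i + d, i + 2 * d)

lemma mem_lowMiddle {n i j k : ℕ} :
    (i, j, k) ∈ lowMiddle n ↔ i < j ∧ j < n ∧ 2 * j = i + k := by
  simp only [lowMiddle, Finset.mem_image, mem_triangle, Prod.mk.injEq]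
  constructor
  · rintro ⟨⟨b, a⟩, h⟩
    dsimp only at h
    omega
  · intro h
    exact ⟨⟨j, i⟩, by dsimp only; omega⟩

lemma mem_highMiddle {n i j k : ℕ} :
    (i, j, k) ∈ highMiddle n ↔ i < j ∧ n ≤ j ∧ k < 2 * n ∧ 2 * j = i + k := by
  simp only [highMiddle, Finset.mem_image, mem_triangle, Prod.mk.injEq]
  constructor
  · rintro ⟨⟨b, a⟩, h⟩
    dsimp only at h
    omega
  · intro h
    exact ⟨⟨2 * n - 1 - j, 2 * n - 1 - k⟩, by dsimp only; omega⟩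

lemma mem_firstMiddle {n i j k : ℕ} :
    (i, j, k) ∈ firstMiddle n ↔ i < j ∧ j < k ∧ k < 2 * n ∧ 2 * i + 2 * n = j + k := by
  simp only [firstMiddle, Finset.mem_image, mem_triangle, Prod.mk.injEq]
  constructor
  · rintro ⟨⟨b, a⟩, h⟩
    dsimp only at h
    omega
  · intro h
    exact ⟨⟨j - i, i⟩, by dsimp only; omega⟩

lemma mem_lastMiddle {n i j k : ℕ} :
    (i, j, k) ∈ lastMiddle n ↔ i < j ∧ j < k ∧ k < 2 * n ∧ 2 * k = i + j + 2 * n := by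
  simp only [lastMiddle, Finset.mem_image, mem_triangle, Prod.mk.injEq]
  constructor
  · rintro ⟨⟨b, a⟩, h⟩
    dsimp only at h
    omega
  · intro h
    exact ⟨⟨k - j, 2 * n - 1 - k⟩, by dsimp only; omega⟩

lemma mem_equilateral {d i j k : ℕ} :
    (i, j, k) ∈ equilateral d ↔ i < d ∧ j = i + d ∧ k = i + 2 * d := by
  simp only [equilateral, Finset.mem_image, Finset.mem_range, Prod.mk.injEq]
  constructor
  · rintro ⟨a, h⟩
    omega
  · intro h
    exact ⟨i, by omega⟩

lemma card_image_triangle {n : ℕ} {f : (Σ _ : ℕ, ℕ) → ℕ × ℕ × ℕ}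
    (hf : ∀ a b a' b', a < b → b < n → a' < b' → b' < n → f ⟨b, a⟩ = f ⟨b', a'⟩ →
      b = b' ∧ a = a') :
    ((triangle n).image f).card = (triangle n).card := by
  refine Finset.card_image_of_injOn ?_
  rintro ⟨b, a⟩ hx ⟨b', a'⟩ hy h
  rw [Finset.mem_coe, mem_triangle] at hx hy
  obtain ⟨rfl, rfl⟩ := hf a b a' b' hx.2 hx.1 hy.2 hy.1 h
  rfl

lemma card_lowMiddle (n : ℕ) : (lowMiddle n).card = (triangle n).card :=
  card_image_triangle fun a b a' b' _ _ _ _ h => by simp only [Prod.mk.injEq] at h; omega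

lemma card_highMiddle (n : ℕ) : (highMiddle n).card = (triangle n).card :=
  card_image_triangle fun a b a' b' _ _ _ _ h => by simp only [Prod.mk.injEq] at h; omega

lemma card_firstMiddle (n : ℕ) : (firstMiddle n).card = (triangle n).card :=
  card_image_triangle fun a b a' b' _ _ _ _ h => by simp only [Prod.mk.injEq] at h; omega

lemma card_lastMiddle (n : ℕ) : (lastMiddle n).card = (triangle n).card :=
  card_image_triangle fun a b a' b' _ _ _ _ h => by simp only [Prod.mk.injEq] at h; omega

lemma card_equilateral (d : ℕ) : (equilateral d).card = d := by
  rw [equilateral, Finset.card_image_of_injective _ fun a b h => (Prod.mk.inj h).1,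
    Finset.card_range]

theorem stmt_6 (n : ℕ) (hn : 3 ≤ n) (hodd : Odd n) (hdvd : 3 ∣ n) :
    {p : ℕ × ℕ × ℕ | p.1 < p.2.1 ∧ p.2.1 < p.2.2 ∧ p.2.2 ≤ 2 * n - 1 ∧
        (2 * p.1 ≡ p.2.1 + p.2.2 [MOD 2 * n] ∨
         2 * p.2.1 ≡ p.1 + p.2.2 [MOD 2 * n] ∨
         2 * p.2.2 ≡ p.1 + p.2.1 [MOD 2 * n])}.ncard = 2 * n * (3 * n - 5) / 3 := by
  obtain ⟨m, rfl⟩ := hdvd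
  set n := 3 * m with hnm
  set E := equilateral (2 * m) with hE
  have hset : {p : ℕ × ℕ × ℕ | p.1 < p.2.1 ∧ p.2.1 < p.2.2 ∧ p.2.2 ≤ 2 * n - 1 ∧
        (2 * p.1 ≡ p.2.1 + p.2.2 [MOD 2 * n] ∨
         2 * p.2.1 ≡ p.1 + p.2.2 [MOD 2 * n] ∨
         2 * p.2.2 ≡ p.1 + p.2.1 [MOD 2 * n])} =
      ↑(((lowMiddle n ∪ highMiddle n) ∪ firstMiddle n \ E) ∪ lastMiddle n \ E) := by
    ext ⟨i, j, k⟩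
    simp only [Set.mem_ofPred_eq, Finset.mem_coe, Finset.mem_union, Finset.mem_sdiff,
      mem_lowMiddle, mem_highMiddle, mem_firstMiddle, mem_lastMiddle, hE, mem_equilateral]
    constructor
    · rintro ⟨hij, hjk, hk, h⟩
      rw [midpoint_modEq_iff hij hjk (by omega)] at h
      omega
    · intro h
      have hij : i < j := by omega
      have hjk : j < k := by omega
      have hk : k < 2 * n := by omega
      rw [midpoint_modEq_iff hij hjk hk]
      omega
  have hd₁ : Disjoint (lowMiddle n) (highMiddle n) := by
    rw [Finset.disjoint_left]
    rintro ⟨i, j, k⟩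
    rw [mem_lowMiddle, mem_highMiddle]
    omega
  have hd₂ : Disjoint (lowMiddle n ∪ highMiddle n) (firstMiddle n \ E) := by
    rw [Finset.disjoint_left]
    rintro ⟨i, j, k⟩
    rw [Finset.mem_union, Finset.mem_sdiff, mem_lowMiddle, mem_highMiddle, mem_firstMiddle,
      hE, mem_equilateral]
    omega
  have hd₃ : Disjoint ((lowMiddle n ∪ highMiddle n) ∪ firstMiddle n \ E) (lastMiddle n \ E) := by
    rw [Finset.disjoint_left]
    rintro ⟨i, j, k⟩
    rw [Finset.mem_union, Finset.mem_union, Finset.mem_sdiff, Finset.mem_sdiff, mem_lowMiddle,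
      mem_highMiddle, mem_firstMiddle, mem_lastMiddle, hE, mem_equilateral]
    omega
  have hs₁ : E ⊆ firstMiddle n := by
    rintro ⟨i, j, k⟩
    rw [hE, mem_equilateral, mem_firstMiddle]
    omega
  have hs₂ : E ⊆ lastMiddle n := by
    rintro ⟨i, j, k⟩
    rw [hE, mem_equilateral, mem_lastMiddle]
    omega
  have hcE : E.card = 2 * m := card_equilateral _
  have hc₁ := Finset.card_sdiff_add_card_eq_card hs₁
  have hc₂ := Finset.card_sdiff_add_card_eq_card hs₂
  rw [card_firstMiddle, hcE] at hc₁
  rw [card_lastMiddle, hcE] at hc₂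
  have ht := card_triangle_mul_two n
  rw [hset, Set.ncard_coe_finset, Finset.card_union_of_disjoint hd₃,
    Finset.card_union_of_disjoint hd₂, Finset.card_union_of_disjoint hd₁, card_lowMiddle,
    card_highMiddle]
  obtain ⟨r, hr⟩ : ∃ r, m = r + 1 := ⟨m - 1, by omega⟩
  have e₁ : n * (n - 1) = 9 * (r * r) + 15 * r + 6 := by
    rw [hnm, hr, show 3 * (r + 1) - 1 = 3 * r + 2 by omega]
    ring
  have e₂ : 2 * n * (3 * n - 5) = 3 * (18 * (r * r) + 26 * r + 8) := by
    rw [hnm, hr, show 3 * (3 * (r + 1)) - 5 = 9 * r + 4 by omega]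
    ring
  rw [e₂, Nat.mul_div_cancel_left _ (by norm_num)]
  rw [e₁] at ht
  omega
end

section
/- Let n ≥ 6 be an even integer and let S ⊆ ℤ/2nℤ with |S| = n such that n ∉ S − S. Then for every fixed integer r with 0 ≤ r ≤ n, the residue (2r + n − 1) mod 2n belongs to S − S. -/
open Finset Pointwise

/-- A set of `n` residues modulo `2 * n` whose difference set avoids `n` meets every pair
`{x, x + n}`. -/
theorem mem_or_add_half_mem {n : ℕ} [NeZero (2 * n)] {S : Finset (ZMod (2 * n))}
    (hcard : S.card = n) (hnot : (n : ZMod (2 * n)) ∉ S - S) (x : ZMod (2 * n)) :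
    x ∈ S ∨ x + n ∈ S := by
  have hdisj : Disjoint S (S.image (· + (n : ZMod (2 * n)))) := by
    refine Finset.disjoint_left.2 fun y hy hy' => ?_
    obtain ⟨z, hz, rfl⟩ := Finset.mem_image.1 hy'
    exact hnot (Finset.mem_sub.2 ⟨_, hy, z, hz, by ring⟩)
  have huniv : S ∪ S.image (· + (n : ZMod (2 * n))) = Finset.univ := by
    apply Finset.eq_univ_of_card
    rw [Finset.card_union_of_disjoint hdisj,
      Finset.card_image_of_injective _ (add_left_injective _), hcard, ZMod.card, two_mul]
  have hzero : (n : ZMod (2 * n)) + n = 0 := by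
    rw [← Nat.cast_add, ← two_mul, ZMod.natCast_self]
  rcases Finset.mem_union.1 (huniv ▸ Finset.mem_univ x) with hx | hx
  · exact Or.inl hx
  · obtain ⟨z, hz, rfl⟩ := Finset.mem_image.1 hx
    right
    rwa [add_assoc, hzero, add_zero]

/-- For even `n`, the difference set of `n` residues modulo `2 * n` that avoids `n` contains
every odd residue. -/
theorem odd_natCast_mem_sub {n : ℕ} (hpos : 0 < n) (heven : Even n) {S : Finset (ZMod (2 * n))}
    (hcard : S.card = n) (hnot : (n : ZMod (2 * n)) ∉ S - S) {d : ℕ} (hd : Odd d) :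
    (d : ZMod (2 * n)) ∈ S - S := by
  have : NeZero (2 * n) := ⟨by omega⟩
  by_contra hdS
  have hstep : ∀ x ∈ S, x + ((d + n : ℕ) : ZMod (2 * n)) ∈ S := by
    intro x hx
    rcases mem_or_add_half_mem hcard hnot (x + d) with h | h
    · exact absurd (Finset.mem_sub.2 ⟨_, h, x, hx, by ring⟩) hdS
    · rwa [Nat.cast_add, ← add_assoc]
  have hiter : ∀ x ∈ S, ∀ k : ℕ, x + k * ((d + n : ℕ) : ZMod (2 * n)) ∈ S := by
    intro x hx k
    induction k with
    | zero => simpa using hx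
    | succ k ih => simpa [add_mul, add_assoc] using hstep _ ih
  obtain ⟨x, hx⟩ : S.Nonempty := Finset.card_pos.1 (hpos.trans_eq hcard.symm)
  obtain ⟨k, hk⟩ := hd.add_even heven
  have hmul : (n : ZMod (2 * n)) * ((d + n : ℕ) : ZMod (2 * n)) = n := by
    rw [hk, ← Nat.cast_mul, show n * (2 * k + 1) = 2 * n * k + n by ring, Nat.cast_add,
      Nat.cast_mul (2 * n), ZMod.natCast_self, zero_mul, zero_add]
  have hxn := hiter x hx n
  rw [hmul] at hxn
  exact hnot (Finset.mem_sub.2 ⟨_, hxn, x, hx, by ring⟩)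

theorem stmt_7 (n : ℕ) (hn : 6 ≤ n) (heven : Even n)
    (S : Finset (ZMod (2 * n))) (hcard : S.card = n)
    (hnot : (n : ZMod (2 * n)) ∉ S - S)
    (r : ℕ) (hr : r ≤ n) :
    ((2 * r + n - 1 : ℕ) : ZMod (2 * n)) ∈ S - S := by
  refine odd_natCast_mem_sub (by omega) heven hcard hnot ?_
  obtain ⟨m, hm⟩ := heven
  exact ⟨r + m - 1, by omega⟩
end

section
/- Let n ≥ 6 be an odd integer (so n ≥ 7) and let S ⊆ ℤ/2nℤ with |S| = n. Then for every fixed integer r with 0 ≤ r ≤ n, the residue (2r + n − 1) mod 2n belongs to S − S. -/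
open Finset Pointwise

theorem mem_sub_self_of_two_mul_card_eq {G : Type*} [AddCommGroup G] [Fintype G] [DecidableEq G]
    {S : Finset G} (hS : 2 * S.card = Fintype.card G) {d : G} {k : ℕ} (hk : Odd k)
    (hd : k • d = 0) : d ∈ S - S := by
  by_contra h
  have hsub : d +ᵥ S ⊆ Sᶜ := by
    intro x hx
    obtain ⟨y, hy, rfl⟩ := Finset.mem_vadd_finset.1 hx
    rw [Finset.mem_compl]
    exact fun hxS => h (Finset.mem_sub.2 ⟨_, hxS, y, hy, by simp⟩)
  have heq : d +ᵥ S = Sᶜ := by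
    refine Finset.eq_of_subset_of_card_le hsub ?_
    rw [Finset.card_vadd_finset, Finset.card_compl]
    omega
  have step (x : G) : d + x ∈ S ↔ x ∉ S := by
    have hx : d +ᵥ x ∈ d +ᵥ S ↔ x ∈ S := Finset.vadd_mem_vadd_finset_iff d
    rw [heq, Finset.mem_compl, vadd_eq_add] at hx
    tauto
  have iter (m : ℕ) : m • d ∈ S ↔ (Even m ↔ (0 : G) ∈ S) := by
    induction m with
    | zero => simp
    | succ m ih =>
      rw [succ_nsmul', step, ih, Nat.even_add_one]
      tauto
  have := iter k
  rw [hd] at this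
  have := Nat.not_even_iff_odd.2 hk
  tauto

theorem stmt_8 (n : ℕ) (hn : 6 ≤ n) (hodd : Odd n)
    (S : Finset (ZMod (2 * n))) (hcard : S.card = n)
    (r : ℕ) (hr : r ≤ n) :
    ((2 * r + n - 1 : ℕ) : ZMod (2 * n)) ∈ S - S := by
  have : NeZero (2 * n) := ⟨by omega⟩
  refine mem_sub_self_of_two_mul_card_eq (by rw [hcard, ZMod.card]) hodd ?_
  rw [nsmul_eq_mul, ← Nat.cast_mul, ZMod.natCast_eq_zero_iff]
  obtain ⟨m, hm⟩ := hodd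
  exact ⟨r + m, by rw [show 2 * r + n - 1 = 2 * (r + m) by omega]; ring⟩
end

section
/- Let n ≥ 6 be an integer and fix an integer r with 0 ≤ r ≤ n. Then there are at least 7·2^{n−3} − 4 subsets S ⊆ ℤ/2nℤ with |S| = n such that n ∉ S − S and {r + t + s (mod 2n) : 0 ≤ t ≤ n−1, s ∈ S} = ℤ/2nℤ. -/
open Finset Pointwise

/-- The transversal of the antipodal pairs `{i, i + n}` of `ℤ/2nℤ` that picks `i` for `i ∈ A` and
`i + n` for `i ∈ {0, …, n - 1} \ A`. -/
def antipodalTransversal (n : ℕ) (A : Finset ℕ) : Finset (ZMod (2 * n)) :=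
  (range n).image fun i => ((if i ∈ A then i else i + n : ℕ) : ZMod (2 * n))

theorem natCast_zmod_inj_of_lt {m a b : ℕ} (ha : a < m) (hb : b < m)
    (h : (a : ZMod m) = b) : a = b := by
  rw [ZMod.natCast_eq_natCast_iff', Nat.mod_eq_of_lt ha, Nat.mod_eq_of_lt hb] at h
  exact h

theorem natCast_mem_antipodalTransversal {n : ℕ} {A : Finset ℕ} {i : ℕ} (hi : i < n) :
    (i : ZMod (2 * n)) ∈ antipodalTransversal n A ↔ i ∈ A := by
  simp only [antipodalTransversal, mem_image, mem_range]
  constructor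
  · rintro ⟨j, hj, h⟩
    have := natCast_zmod_inj_of_lt (by split_ifs <;> omega) (by omega) h
    split_ifs at this with hA
    · exact this ▸ hA
    · omega
  · exact fun hA => ⟨i, hi, by rw [if_pos hA]⟩

theorem natCast_add_mem_antipodalTransversal {n : ℕ} {A : Finset ℕ} {i : ℕ} (hi : i < n) :
    ((i + n : ℕ) : ZMod (2 * n)) ∈ antipodalTransversal n A ↔ i ∉ A := by
  simp only [antipodalTransversal, mem_image, mem_range]
  constructor
  · rintro ⟨j, hj, h⟩
    have := natCast_zmod_inj_of_lt (by split_ifs <;> omega) (by omega) h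
    split_ifs at this with hA
    · omega
    · rwa [Nat.add_right_cancel this] at hA
  · exact fun hA => ⟨i, hi, by rw [if_neg hA]⟩

theorem card_antipodalTransversal (n : ℕ) (A : Finset ℕ) :
    (antipodalTransversal n A).card = n := by
  rw [antipodalTransversal, card_image_of_injOn, card_range]
  intro i hi j hj h
  simp only [coe_range, Set.mem_Iio] at hi hj
  have := natCast_zmod_inj_of_lt (by split_ifs <;> omega) (by split_ifs <;> omega) h
  split_ifs at this <;> omega

theorem natCast_notMem_antipodalTransversal_sub (n : ℕ) (A : Finset ℕ) :
    (n : ZMod (2 * n)) ∉ antipodalTransversal n A - antipodalTransversal n A := by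
  rw [Finset.mem_sub]
  rintro ⟨a, ha, b, hb, h⟩
  simp only [antipodalTransversal, mem_image, mem_range] at ha hb
  obtain ⟨i, hi, rfl⟩ := ha
  obtain ⟨j, hj, rfl⟩ := hb
  rw [sub_eq_iff_eq_add, ← Nat.cast_add] at h
  by_cases hjA : j ∈ A
  · rw [if_pos hjA] at h
    have := natCast_zmod_inj_of_lt (by split_ifs <;> omega) (by omega) h
    split_ifs at this with hiA
    · omega
    · exact hiA (by rwa [show i = j by omega])
  · rw [if_neg hjA, show n + (j + n) = j + 2 * n by ring, Nat.cast_add j, ZMod.natCast_self,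
      add_zero] at h
    have := natCast_zmod_inj_of_lt (by split_ifs <;> omega) (by omega) h
    split_ifs at this with hiA
    · exact hjA (this ▸ hiA)
    · omega

theorem antipodalTransversal_injOn (n : ℕ) :
    Set.InjOn (antipodalTransversal n) ((range n).powerset : Set (Finset ℕ)) := by
  intro A hA B hB h
  simp only [coe_powerset, Set.mem_preimage, Set.mem_powerset_iff, coe_subset] at hA hB
  ext i
  by_cases hi : i < n
  · rw [← natCast_mem_antipodalTransversal hi, h, natCast_mem_antipodalTransversal hi]
  · exact iff_of_false (fun h => hi (mem_range.1 (hA h))) (fun h => hi (mem_range.1 (hB h)))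

/-- If an antipodal transversal avoids `n` consecutive residues, then it comes from an initial or a
final segment of `{0, …, n - 1}`. -/
theorem eq_range_or_eq_Ico_of_window {n : ℕ} (hn : 0 < n) {A : Finset ℕ} (hA : A ⊆ range n)
    (y : ZMod (2 * n)) (hy : ∀ t < n, y + (t : ℕ) ∉ antipodalTransversal n A) :
    ∃ k < n, A = range k ∨ A = Ico k n := by
  have : NeZero (2 * n) := ⟨by omega⟩
  obtain ⟨a, ha, rfl⟩ : ∃ a < 2 * n, (a : ZMod (2 * n)) = y :=
    ⟨y.val, y.val_lt, ZMod.natCast_zmod_val y⟩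
  simp only [← Nat.cast_add] at hy
  have lt_of_mem {i : ℕ} (hi : i ∈ A) : i < n := mem_range.1 (hA hi)
  by_cases han : a < n
  · refine ⟨a, han, Or.inl ?_⟩
    ext i
    rw [mem_range]
    constructor
    · intro hi
      by_contra! hai
      have hin := lt_of_mem hi
      apply hy (i - a) (by omega)
      rwa [show a + (i - a) = i by omega, natCast_mem_antipodalTransversal hin]
    · intro hi
      by_contra hiA
      apply hy (i + n - a) (by omega)
      rwa [show a + (i + n - a) = i + n by omega,
        natCast_add_mem_antipodalTransversal (by omega)]
  · refine ⟨a - n, by omega, Or.inr ?_⟩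
    ext i
    rw [mem_Ico]
    constructor
    · intro hi
      have hin := lt_of_mem hi
      refine ⟨?_, hin⟩
      by_contra! hai
      apply hy (i + 2 * n - a) (by omega)
      rwa [show a + (i + 2 * n - a) = i + 2 * n by omega, Nat.cast_add i, ZMod.natCast_self,
        add_zero, natCast_mem_antipodalTransversal hin]
    · rintro ⟨hai, hin⟩
      by_contra hiA
      apply hy (i + n - a) (by omega)
      rwa [show a + (i + n - a) = i + n by omega,
        natCast_add_mem_antipodalTransversal hin]

theorem seven_mul_two_pow_le {n : ℕ} (hn : 6 ≤ n) :
    7 * 2 ^ (n - 3) - 4 ≤ 2 ^ n - 2 * n := by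
  obtain ⟨m, rfl⟩ := Nat.exists_eq_add_of_le hn
  have h : m + 1 ≤ 2 ^ m := m.lt_two_pow_self
  rw [show 6 + m - 3 = m + 3 by omega, show 6 + m = m + 6 by omega, pow_add, pow_add]
  omega

theorem stmt_10 (n : ℕ) (hn : 6 ≤ n) (r : ℕ) (hr : r ≤ n) :
    7 * 2 ^ (n - 3) - 4 ≤
      {S : Finset (ZMod (2 * n)) | S.card = n ∧ (n : ZMod (2 * n)) ∉ S - S ∧
        {x : ZMod (2 * n) | ∃ t : ℕ, t ≤ n - 1 ∧ ∃ s ∈ S, x = (r : ZMod (2 * n)) + t + s}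
          = Set.univ}.ncard := by
  have : NeZero (2 * n) := ⟨by omega⟩
  let segments : Finset (Finset ℕ) :=
    (range n).image (fun k => range k) ∪ (range n).image (fun k => Ico k n)
  have card_segments : segments.card ≤ 2 * n := by
    refine (card_union_le _ _).trans ?_
    rw [two_mul]
    exact add_le_add (card_image_le.trans_eq (card_range n)) (card_image_le.trans_eq (card_range n))
  have card_diff : 2 ^ n - 2 * n ≤ ((range n).powerset \ segments).card := by
    have := le_card_sdiff segments (range n).powerset
    rw [card_powerset, card_range] at this
    omega
  refine (seven_mul_two_pow_le hn).trans (card_diff.trans ?_)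
  rw [← card_image_of_injOn ((antipodalTransversal_injOn n).mono (coe_subset.2 sdiff_subset)),
    ← Set.ncard_coe_finset]
  refine Set.ncard_le_ncard ?_ (Set.toFinite _)
  intro S hS
  obtain ⟨A, hA, rfl⟩ := mem_image.1 (mem_coe.1 hS)
  obtain ⟨hAn, hA⟩ := mem_sdiff.1 hA
  refine ⟨card_antipodalTransversal n A, natCast_notMem_antipodalTransversal_sub n A, ?_⟩
  refine Set.eq_univ_of_forall fun x => ?_
  by_contra hx
  obtain ⟨k, hk, h⟩ := eq_range_or_eq_Ico_of_window (by omega) (mem_powerset.1 hAn)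
    (x - r - ((n - 1 : ℕ) : ZMod (2 * n))) fun t ht hmem => hx
      ⟨n - 1 - t, by omega, _, hmem, by rw [Nat.cast_sub (by omega : t ≤ n - 1)]; ring⟩
  apply hA
  simp only [segments, mem_union, mem_image, mem_range]
  exact h.imp (fun h => ⟨k, hk, h.symm⟩) (fun h => ⟨k, hk, h.symm⟩)
end

section
/- Let n ≥ 3 be an odd integer with 3 ∤ n. Among the subsets of Dic_{4n} of the form A = {a^i, a^j, a^k} with 0 ≤ i < j < k ≤ 2n−1 (i.e., three-element subsets of the cyclic subgroup generated by a): the number of MSTD such subsets is 0, the number of MDTS such subsets is 4n(n−1)(n−2)/3, and the number of balanced such subsets is 2n(n−1). -/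
open Finset Pointwise

/-- Subsets of the form `{a^i, a^j, a^k}` with `0 ≤ i < j < k ≤ 2n-1`. -/
def IsTypeA (n : ℕ) (A : Finset (QuaternionGroup n)) : Prop :=
  ∃ i j k : ℕ, i < j ∧ j < k ∧ k ≤ 2 * n - 1 ∧
    A = {QuaternionGroup.a (i : ZMod (2 * n)), QuaternionGroup.a (j : ZMod (2 * n)),
         QuaternionGroup.a (k : ZMod (2 * n))}

section ZModTwoMul

variable {n : ℕ}

lemma two_mul_eq_zero_iff_of_zmod [NeZero n] (d : ZMod (2 * n)) :
    2 * d = 0 ↔ d = 0 ∨ d = (n : ZMod (2 * n)) := by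
  constructor
  · intro h
    have hv : d = (d.val : ZMod (2 * n)) := (ZMod.natCast_zmod_val d).symm
    have hlt : d.val < 2 * n := ZMod.val_lt d
    rw [hv] at h
    have h2 : ((2 * d.val : ℕ) : ZMod (2 * n)) = 0 := by push_cast; exact h
    rw [ZMod.natCast_eq_zero_iff] at h2
    obtain ⟨c, hc⟩ := Nat.dvd_of_mul_dvd_mul_left two_pos h2
    have hc2 : c < 2 := by
      by_contra! hge
      nlinarith
    interval_cases c
    · left; rw [hv, hc]; simp
    · right; rw [hv, hc]; simp
  · rintro (rfl | rfl)
    · simp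
    · exact_mod_cast ZMod.natCast_self (2 * n)

lemma two_mul_ne_natCast_of_odd (hodd : Odd n) (d : ZMod (2 * n)) :
    2 * d ≠ (n : ZMod (2 * n)) := by
  intro h
  have h' := congrArg (ZMod.castHom (dvd_mul_right 2 n) (ZMod 2)) h
  rw [map_mul, map_natCast, (ZMod.natCast_eq_one_iff_odd).2 hodd, map_ofNat] at h'
  have h2 : (2 : ZMod 2) = 0 := rfl
  rw [h2, zero_mul] at h'
  exact zero_ne_one h'

lemma eq_zero_of_three_mul_eq_zero (hndvd : ¬ 3 ∣ n) (d : ZMod (2 * n)) (h : 3 * d = 0) :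
    d = 0 := by
  have hc : Nat.Coprime 3 (2 * n) := by
    rw [Nat.Prime.coprime_iff_not_dvd Nat.prime_three, Nat.Prime.dvd_mul Nat.prime_three]
    simp [hndvd]
  have hu : IsUnit (3 : ZMod (2 * n)) := by
    exact_mod_cast (ZMod.isUnit_iff_coprime 3 (2 * n)).2 hc
  exact hu.mul_right_eq_zero.1 h

end ZModTwoMul

section Triple

variable {R : Type*} [CommRing R] [DecidableEq R]

lemma triple_add_triple (x y z : R) :
    ({x, y, z} : Finset R) + {x, y, z} = {x + x, y + y, z + z, x + y, x + z, y + z} := by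
  ext w
  simp only [Finset.mem_add, Finset.mem_insert, Finset.mem_singleton, exists_eq_or_imp,
    exists_eq_left]
  grind

lemma triple_sub_triple (x y z : R) :
    ({x, y, z} : Finset R) - {x, y, z}
      = {0, x - y, y - x, x - z, z - x, y - z, z - y} := by
  ext w
  simp only [Finset.mem_sub, Finset.mem_insert, Finset.mem_singleton, exists_eq_or_imp,
    exists_eq_left]
  grind

lemma card_add_eq_card_sub_of_progression (x d : R) (h2 : 2 * d ≠ 0) (h3 : 3 * d ≠ 0)
    (h4 : 4 * d ≠ 0) :
    (({x - d, x, x + d} : Finset R) + {x - d, x, x + d}).card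
      = (({x - d, x, x + d} : Finset R) - {x - d, x, x + d}).card := by
  have h1 : d ≠ 0 := by rintro rfl; simp at h2
  have hs : ({x - d, x, x + d} : Finset R) + {x - d, x, x + d}
      = ({0, d, -d, 2 * d, -(2 * d)} : Finset R).image (fun t => 2 * x + t) := by
    rw [triple_add_triple]
    ext w
    simp only [Finset.mem_insert, Finset.mem_singleton, Finset.mem_image]
    grind
  have hd : ({x - d, x, x + d} : Finset R) - {x - d, x, x + d}
      = {0, d, -d, 2 * d, -(2 * d)} := by
    rw [triple_sub_triple]
    ext w
    simp only [Finset.mem_insert, Finset.mem_singleton]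
    grind
  rw [hs, hd, Finset.card_image_of_injective _ (add_right_injective _)]

lemma card_add_lt_card_sub_of_generic {x y z : R}
    (hxy : 2 * (x - y) ≠ 0) (hxz : 2 * (x - z) ≠ 0) (hyz : 2 * (y - z) ≠ 0)
    (hx : 2 * x ≠ y + z) (hy : 2 * y ≠ x + z) (hz : 2 * z ≠ x + y) :
    (({x, y, z} : Finset R) + {x, y, z}).card
      < (({x, y, z} : Finset R) - {x, y, z}).card := by
  have h1 : (({x, y, z} : Finset R) + {x, y, z}).card ≤ 6 := by
    rw [triple_add_triple]; exact Finset.card_le_six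
  have h2 : (({x, y, z} : Finset R) - {x, y, z}).card = 7 := by
    rw [triple_sub_triple]
    repeat rw [Finset.card_insert_of_notMem (by
      simp only [Finset.mem_insert, Finset.mem_singleton]; grind)]
    simp
  omega

lemma card_add_lt_card_sub_of_involution {x y z : R} (hne : x ≠ y)
    (hxy : 2 * (x - y) = 0) (hxz : 2 * (x - z) ≠ 0)
    (hz : 2 * z ≠ x + y) :
    (({x, y, z} : Finset R) + {x, y, z}).card
      < (({x, y, z} : Finset R) - {x, y, z}).card := by
  have h1 : (({x, y, z} : Finset R) + {x, y, z}).card ≤ 5 := by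
    have : ({x, y, z} : Finset R) + {x, y, z} = {x + x, z + z, x + y, x + z, y + z} := by
      rw [triple_add_triple]
      ext w
      simp only [Finset.mem_insert, Finset.mem_singleton]
      grind
    rw [this]; exact Finset.card_le_five
  have h2 : (({x, y, z} : Finset R) - {x, y, z}).card = 6 := by
    have : ({x, y, z} : Finset R) - {x, y, z}
        = {0, x - y, x - z, z - x, y - z, z - y} := by
      rw [triple_sub_triple]
      ext w
      simp only [Finset.mem_insert, Finset.mem_singleton]
      grind
    rw [this]
    repeat rw [Finset.card_insert_of_notMem (by
      simp only [Finset.mem_insert, Finset.mem_singleton]; grind)]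
    simp
  omega

end Triple

/-- A three-term arithmetic progression `x - d, x, x + d` with `2 * d ≠ 0`. -/
def IsProgression {R : Type*} [CommRing R] [DecidableEq R] (B : Finset R) : Prop :=
  ∃ x d : R, 2 * d ≠ 0 ∧ B = {x - d, x, x + d}

lemma IsProgression.of_two_mul_eq {R : Type*} [CommRing R] [DecidableEq R] {x y z : R}
    (hyz : y ≠ z) (h : 2 * x = y + z) : IsProgression ({x, y, z} : Finset R) := by
  refine ⟨x, z - x, by grind, ?_⟩
  ext w
  simp only [Finset.mem_insert, Finset.mem_singleton]
  grind

section Counting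

variable {n : ℕ}

lemma IsProgression.card_eq_three {R : Type*} [CommRing R] [DecidableEq R] {B : Finset R}
    (hB : IsProgression B) : B.card = 3 := by
  obtain ⟨x, d, h2, rfl⟩ := hB
  rw [Finset.card_eq_three]
  exact ⟨x - d, x, x + d, by grind, by grind, by grind, rfl⟩

lemma IsProgression.card_add_eq_card_sub [NeZero n] (hodd : Odd n) (hndvd : ¬ 3 ∣ n)
    {B : Finset (ZMod (2 * n))} (hB : IsProgression B) : (B + B).card = (B - B).card := by
  obtain ⟨x, d, h2, rfl⟩ := hB
  refine card_add_eq_card_sub_of_progression x d h2 (fun h => h2 ?_) (fun h => ?_)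
  · rw [eq_zero_of_three_mul_eq_zero hndvd d h, mul_zero]
  · have h' : 2 * (2 * d) = 0 := by linear_combination h
    rcases (two_mul_eq_zero_iff_of_zmod _).1 h' with h' | h'
    · exact h2 h'
    · exact two_mul_ne_natCast_of_odd hodd _ h'

lemma card_add_lt_card_sub_of_not_isProgression [NeZero n]
    {B : Finset (ZMod (2 * n))} (hB : B.card = 3) (hp : ¬ IsProgression B) :
    (B + B).card < (B - B).card := by
  obtain ⟨x, y, z, hxy, hxz, hyz, rfl⟩ := Finset.card_eq_three.1 hB
  have hperm₁ : ({x, y, z} : Finset (ZMod (2 * n))) = {y, x, z} := Finset.insert_comm x y {z}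
  have hperm₂ : ({x, y, z} : Finset (ZMod (2 * n))) = {x, z, y} := by
    rw [Finset.pair_comm y z]
  have hperm₃ : ({x, y, z} : Finset (ZMod (2 * n))) = {z, x, y} := by
    rw [hperm₂, Finset.insert_comm]
  have hperm₄ : ({x, y, z} : Finset (ZMod (2 * n))) = {y, z, x} := by
    rw [hperm₁, Finset.pair_comm x z]
  have hx : 2 * x ≠ y + z := fun h => hp (.of_two_mul_eq hyz h)
  have hy : 2 * y ≠ x + z := fun h => hp (hperm₁ ▸ .of_two_mul_eq hxz h)
  have hz : 2 * z ≠ x + y := fun h => hp (hperm₃ ▸ .of_two_mul_eq hxy h)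
  have key : ∀ u v : ZMod (2 * n), u ≠ v → 2 * (u - v) = 0 → u - v = n := fun u v huv h =>
    ((two_mul_eq_zero_iff_of_zmod _).1 h).resolve_left (sub_ne_zero.2 huv)
  have hn2 : 2 * (n : ZMod (2 * n)) = 0 := (two_mul_eq_zero_iff_of_zmod _).2 (.inr rfl)
  by_cases h₁ : 2 * (x - y) = 0
  · have := key _ _ hxy h₁
    have a1 := key _ _ hxz
    have a2 := key _ _ hyz
    exact card_add_lt_card_sub_of_involution hxy h₁ (by grind) hz
  by_cases h₂ : 2 * (x - z) = 0
  · have := key _ _ hxz h₂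
    have a1 := key _ _ hyz
    rw [hperm₂]
    exact card_add_lt_card_sub_of_involution hxz h₂ h₁ hy
  by_cases h₃ : 2 * (y - z) = 0
  · rw [hperm₄]
    exact card_add_lt_card_sub_of_involution hyz h₃ (by grind) hx
  exact card_add_lt_card_sub_of_generic h₁ h₂ h₃ hx hy hz

lemma ncard_isProgression [NeZero n] (hndvd : ¬ 3 ∣ n) :
    {B : Finset (ZMod (2 * n)) | IsProgression B}.ncard = 2 * n * (n - 1) := by
  let f : ZMod (2 * n) × ℕ → Finset (ZMod (2 * n)) :=
    fun p => {p.1 - (p.2 : ZMod (2 * n)), p.1, p.1 + (p.2 : ZMod (2 * n))}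
  let s : Finset (ZMod (2 * n) × ℕ) := Finset.univ ×ˢ Finset.Ico 1 n
  have hcast : ∀ k : ℕ, k < 2 * n → (k : ZMod (2 * n)) = 0 → k = 0 := fun k hk h =>
    Nat.eq_zero_of_dvd_of_lt ((ZMod.natCast_eq_zero_iff _ _).1 h) hk
  have hpos : ∀ k : ℕ, 1 ≤ k → k < n → 2 * (k : ZMod (2 * n)) ≠ 0 := by
    intro k h1 h2 h
    have := hcast (2 * k) (by omega) (by push_cast; exact h)
    omega
  have himage : {B : Finset (ZMod (2 * n)) | IsProgression B} = f '' (s : Set _) := by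
    ext B
    simp only [Set.mem_ofPred_eq, Set.mem_image, Finset.mem_coe, s, Finset.mem_product,
      Finset.mem_univ, true_and, Finset.mem_Ico, f]
    constructor
    · rintro ⟨x, d, h2, rfl⟩
      have hd : (d.val : ZMod (2 * n)) = d := ZMod.natCast_zmod_val d
      have hlt : d.val < 2 * n := ZMod.val_lt d
      have h0 : d.val ≠ 0 := fun h => h2 (by rw [← hd, h]; simp)
      have hn : d.val ≠ n := fun h => h2 <|
        (two_mul_eq_zero_iff_of_zmod d).2 (.inr (by rw [← hd, h]))
      rcases lt_or_gt_of_ne hn with h | h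
      · exact ⟨(x, d.val), ⟨by omega, h⟩, by simp only [hd]⟩
      · refine ⟨(x, 2 * n - d.val), ⟨by dsimp only; omega, by dsimp only; omega⟩, ?_⟩
        have hneg : ((2 * n - d.val : ℕ) : ZMod (2 * n)) = -d := by
          rw [Nat.cast_sub hlt.le, ZMod.natCast_self, hd, zero_sub]
        simp only [hneg]
        ext w
        simp only [Finset.mem_insert, Finset.mem_singleton]
        grind
    · rintro ⟨⟨x, k⟩, ⟨h1, h2⟩, rfl⟩
      exact ⟨x, k, hpos k h1 h2, rfl⟩
  have hinj : Set.InjOn f (s : Set _) := by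
    rintro ⟨x, k⟩ hk ⟨y, l⟩ hl h
    simp only [Finset.mem_coe, s, Finset.mem_product,
      Finset.mem_univ, true_and, Finset.mem_Ico] at hk hl
    simp only [f] at h
    have hk2 := hpos k hk.1 hk.2
    have hl2 := hpos l hl.1 hl.2
    have hsum : 3 * (x - y) = 0 := by
      have e1 : ∑ w ∈ ({x - (k : ZMod (2 * n)), x, x + (k : ZMod (2 * n))} : Finset _), w
          = 3 * x := by
        rw [Finset.sum_insert (by simp only [Finset.mem_insert, Finset.mem_singleton]; grind),
          Finset.sum_insert (by simp only [Finset.mem_singleton]; grind),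
          Finset.sum_singleton]
        ring
      have e2 : ∑ w ∈ ({y - (l : ZMod (2 * n)), y, y + (l : ZMod (2 * n))} : Finset _), w
          = 3 * y := by
        rw [Finset.sum_insert (by simp only [Finset.mem_insert, Finset.mem_singleton]; grind),
          Finset.sum_insert (by simp only [Finset.mem_singleton]; grind),
          Finset.sum_singleton]
        ring
      rw [h, e2] at e1
      linear_combination -e1
    obtain rfl : x = y := sub_eq_zero.1 (eq_zero_of_three_mul_eq_zero hndvd _ hsum)
    have hmem : x + (k : ZMod (2 * n)) ∈
        ({x - (l : ZMod (2 * n)), x, x + (l : ZMod (2 * n))} : Finset _) := by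
      rw [← h]; simp
    simp only [Finset.mem_insert, Finset.mem_singleton] at hmem
    have hkl : k = l := by
      rcases hmem with hm | hm | hm
      · have := hcast (k + l) (by omega) (by push_cast; linear_combination hm)
        omega
      · exact absurd (show 2 * (k : ZMod (2 * n)) = 0 by linear_combination 2 * hm) hk2
      · have hm' : (k : ZMod (2 * n)) = l := add_left_cancel hm
        rw [ZMod.natCast_eq_natCast_iff'] at hm'
        rwa [Nat.mod_eq_of_lt (by omega), Nat.mod_eq_of_lt (by omega)] at hm'
    rw [hkl]
  rw [himage, hinj.ncard_image, Set.ncard_coe_finset]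
  simp [s, ZMod.card]

lemma ncard_card_eq_three_and_not_isProgression [NeZero n] (hndvd : ¬ 3 ∣ n) :
    {B : Finset (ZMod (2 * n)) | B.card = 3 ∧ ¬ IsProgression B}.ncard
      = 4 * n * (n - 1) * (n - 2) / 3 := by
  have hdiff : {B : Finset (ZMod (2 * n)) | B.card = 3 ∧ ¬ IsProgression B}
      = {B | B.card = 3} \ {B | IsProgression B} := rfl
  have htotal : {B : Finset (ZMod (2 * n)) | B.card = 3}.ncard = (2 * n).choose 3 := by
    have : {B : Finset (ZMod (2 * n)) | B.card = 3}
        = (Finset.powersetCard 3 Finset.univ : Finset (Finset (ZMod (2 * n)))) := by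
      ext B
      simp [Finset.mem_powersetCard]
    rw [this, Set.ncard_coe_finset, Finset.card_powersetCard, Finset.card_univ, ZMod.card]
  have hsub : {B : Finset (ZMod (2 * n)) | IsProgression B} ⊆ {B | B.card = 3} :=
    fun _ hB => IsProgression.card_eq_three hB
  rw [hdiff, Set.ncard_sdiff hsub (Set.toFinite _),
    htotal, ncard_isProgression hndvd]
  have hfact := Nat.descFactorial_eq_factorial_mul_choose (2 * n) 3
  rw [show Nat.factorial 3 = 6 from rfl] at hfact
  simp only [Nat.descFactorial] at hfact
  obtain rfl | ⟨m, rfl⟩ : n = 1 ∨ ∃ m, n = m + 2 := by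
    have := NeZero.ne n
    rcases Nat.lt_or_ge n 2 with h | h
    · left; omega
    · right; exact ⟨n - 2, by omega⟩
  · rfl
  · have e1 : 2 * (m + 2) - 2 = 2 * m + 2 := by omega
    have e2 : 2 * (m + 2) - 1 = 2 * m + 3 := by omega
    have e3 : m + 2 - 1 = m + 1 := by omega
    have e4 : m + 2 - 2 = m := by omega
    rw [e1, e2, Nat.sub_zero] at hfact
    rw [e3, e4]
    have hsum : 3 * (2 * (m + 2)).choose 3
        = 4 * (m + 2) * (m + 1) * m + 3 * (2 * (m + 2) * (m + 1)) := by
      linarith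
    omega

end Counting

section Transfer

variable {n : ℕ}

lemma a_injective : Function.Injective (QuaternionGroup.a : ZMod (2 * n) → QuaternionGroup n) :=
  fun _ _ h => QuaternionGroup.a.inj h

lemma image_a_mul_image_a (B : Finset (ZMod (2 * n))) :
    B.image QuaternionGroup.a * B.image QuaternionGroup.a
      = ((B + B).image QuaternionGroup.a : Finset (QuaternionGroup n)) :=
  (Finset.image_image₂_distrib fun i j => (QuaternionGroup.a_mul_a i j).symm).symm

lemma image_a_div_image_a (B : Finset (ZMod (2 * n))) :
    B.image QuaternionGroup.a / B.image QuaternionGroup.a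
      = ((B - B).image QuaternionGroup.a : Finset (QuaternionGroup n)) := by
  refine (Finset.image_image₂_distrib fun i j => ?_).symm
  rw [eq_div_iff_mul_eq', QuaternionGroup.a_mul_a, sub_add_cancel]

lemma isTypeA_iff [NeZero n] (A : Finset (QuaternionGroup n)) :
    IsTypeA n A ↔ ∃ B : Finset (ZMod (2 * n)), B.card = 3 ∧ B.image QuaternionGroup.a = A := by
  constructor
  · rintro ⟨i, j, k, hij, hjk, hk, rfl⟩
    have hn := NeZero.pos n
    have hne : ∀ u v : ℕ, u < v → v < 2 * n → (u : ZMod (2 * n)) ≠ v := by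
      intro u v huv hv h
      rw [ZMod.natCast_eq_natCast_iff', Nat.mod_eq_of_lt (by omega), Nat.mod_eq_of_lt hv] at h
      omega
    refine ⟨{(i : ZMod (2 * n)), (j : ZMod (2 * n)), (k : ZMod (2 * n))},
      Finset.card_eq_three.2 ⟨_, _, _, hne i j hij (by omega), hne i k (by omega) (by omega),
        hne j k hjk (by omega), rfl⟩, ?_⟩
    simp [Finset.image_insert]
  · rintro ⟨B, hB, rfl⟩
    have hC : (B.image ZMod.val).card = 3 := by
      rw [Finset.card_image_of_injective _ (ZMod.val_injective _), hB]
    have hBC : B = (B.image ZMod.val).image (fun t : ℕ => (t : ZMod (2 * n))) := by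
      rw [Finset.image_image]
      conv_lhs => rw [← Finset.image_id (s := B)]
      exact Finset.image_congr fun x _ => (ZMod.natCast_zmod_val x).symm
    have hlt : ∀ t ∈ B.image ZMod.val, t < 2 * n := by
      intro t ht
      obtain ⟨x, -, rfl⟩ := Finset.mem_image.1 ht
      exact ZMod.val_lt x
    let e := (B.image ZMod.val).orderEmbOfFin hC
    have hmem : ∀ i, e i ∈ B.image ZMod.val := fun i => Finset.orderEmbOfFin_mem _ hC i
    have hCe : B.image ZMod.val = {e 0, e 1, e 2} := by
      rw [← Finset.image_orderEmbOfFin_univ _ hC,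
        show (Finset.univ : Finset (Fin 3)) = {0, 1, 2} from rfl, Finset.image_insert,
        Finset.image_insert, Finset.image_singleton]
    refine ⟨e 0, e 1, e 2, e.strictMono (by decide), e.strictMono (by decide), ?_, ?_⟩
    · have := hlt _ (hmem 2)
      omega
    · rw [hBC, hCe]
      simp [Finset.image_insert]

lemma ncard_isTypeA_and [NeZero n] {P : Finset (QuaternionGroup n) → Prop}
    {Q : Finset (ZMod (2 * n)) → Prop}
    (h : ∀ B : Finset (ZMod (2 * n)), B.card = 3 → (P (B.image QuaternionGroup.a) ↔ Q B)) :
    {A : Finset (QuaternionGroup n) | IsTypeA n A ∧ P A}.ncard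
      = {B : Finset (ZMod (2 * n)) | B.card = 3 ∧ Q B}.ncard := by
  rw [← Set.ncard_image_of_injective _ (Finset.image_injective a_injective)]
  congr 1
  ext A
  simp only [Set.mem_ofPred_eq, Set.mem_image, isTypeA_iff]
  constructor
  · rintro ⟨⟨B, hB, rfl⟩, hP⟩
    exact ⟨B, ⟨hB, (h B hB).1 hP⟩, rfl⟩
  · rintro ⟨B, ⟨hB, hQ⟩, rfl⟩
    exact ⟨⟨B, hB, rfl⟩, (h B hB).2 hQ⟩

end Transfer

theorem stmt_11 (n : ℕ) (hn : 3 ≤ n) (hodd : Odd n) (hndvd : ¬ 3 ∣ n) :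
    {A : Finset (QuaternionGroup n) | IsTypeA n A ∧ IsMSTD A}.ncard = 0 ∧
    {A : Finset (QuaternionGroup n) | IsTypeA n A ∧ IsMDTS A}.ncard
        = 4 * n * (n - 1) * (n - 2) / 3 ∧
    {A : Finset (QuaternionGroup n) | IsTypeA n A ∧ IsBalanced A}.ncard
        = 2 * n * (n - 1) := by
  have : NeZero n := ⟨by omega⟩
  have hmul (B : Finset (ZMod (2 * n))) :
      ((B.image QuaternionGroup.a * B.image QuaternionGroup.a :
        Finset (QuaternionGroup n))).card = (B + B).card := by
    rw [image_a_mul_image_a, Finset.card_image_of_injective _ a_injective]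
  have hdiv (B : Finset (ZMod (2 * n))) :
      ((B.image QuaternionGroup.a / B.image QuaternionGroup.a :
        Finset (QuaternionGroup n))).card = (B - B).card := by
    rw [image_a_div_image_a, Finset.card_image_of_injective _ a_injective]
  have heq (B : Finset (ZMod (2 * n))) (hp : IsProgression B) :=
    hp.card_add_eq_card_sub hodd hndvd
  have hlt (B : Finset (ZMod (2 * n))) (hB : B.card = 3) (hp : ¬ IsProgression B) :=
    card_add_lt_card_sub_of_not_isProgression hB hp
  refine ⟨?_, ?_, ?_⟩
  · rw [ncard_isTypeA_and (Q := fun _ => False)]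
    · simp
    · intro B hB
      rw [IsMSTD, hmul, hdiv, iff_false, not_lt]
      by_cases hp : IsProgression B
      · exact (heq B hp).le
      · exact (hlt B hB hp).le
  · rw [ncard_isTypeA_and (Q := fun B => ¬ IsProgression B)]
    · exact ncard_card_eq_three_and_not_isProgression hndvd
    · intro B hB
      rw [IsMDTS, hmul, hdiv]
      exact ⟨fun h hp => h.ne (heq B hp), hlt B hB⟩
  · rw [ncard_isTypeA_and (Q := IsProgression)]
    · rw [← ncard_isProgression hndvd]
      congr 1
      ext B
      exact ⟨And.right, fun hp => ⟨hp.card_eq_three, hp⟩⟩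
    · intro B hB
      rw [IsBalanced, hmul, hdiv]
      exact ⟨fun h => by_contra fun hp => (hlt B hB hp).ne h, heq B⟩
end
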